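/- Let R be a semilocal ring with nilpotent Jacobson radical, and M a right R-module. Then M is hereditarily Bassian if and only if Soc(M) is finitely generated. -/

import Mathlib

/-- A module `M` is *Bassian* if every monomorphism `M → M/N` forces `N = 0`. -/
def IsBassian (R : Type*) [Ring R] (M : Type*) [AddCommGroup M] [Module R M] : Prop :=
  ∀ N : Submodule R M, (∃ f : M →ₗ[R] M ⧸ N, Function.Injective f) → N = ⊥

/-- A module `M` is *super Bassian* if every quotient of `M` is Bassian. -/
def IsSuperBassian (R : Type*) [Ring R] (M : Type*) [AddCommGroup M] [Module R M] : Prop :=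
  ∀ K : Submodule R M, IsBassian R (M ⧸ K)

/-- A module `M` is *hereditarily Bassian* if every submodule of `M` is Bassian. -/
def IsHereditarilyBassian (R : Type*) [Ring R] (M : Type*) [AddCommGroup M] [Module R M] :
    Prop :=
  ∀ N : Submodule R M, IsBassian R N

/-- The *socle* of a module: the sum of all its simple submodules, i.e. the supremum of
the atoms of its submodule lattice. -/
def Socle (R : Type*) [Ring R] (M : Type*) [AddCommGroup M] [Module R M] : Submodule R M :=
  sSup {N : Submodule R M | IsAtom N}

section

variable {R : Type*} [Ring R] {M : Type*} [AddCommGroup M] [Module R M]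

theorem isBassian_of_linearEquiv {M' : Type*} [AddCommGroup M'] [Module R M'] (e : M ≃ₗ[R] M')
    (h : IsBassian R M) : IsBassian R M' := by
  rintro N ⟨f, hf⟩
  let q : (M' ⧸ N) ≃ₗ[R] M ⧸ N.map e.symm.toLinearMap :=
    Submodule.Quotient.equiv N _ e.symm rfl
  exact (Submodule.map_eq_bot_iff (e := e.symm)).mp <|
    h _ ⟨q.toLinearMap ∘ₗ f ∘ₗ e.toLinearMap, q.injective.comp (hf.comp e.injective)⟩

/-- A Bassian module is Hopfian. -/
theorem IsBassian.injective_of_surjective (h : IsBassian R M) (f : M →ₗ[R] M)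
    (hf : Function.Surjective f) : Function.Injective f :=
  LinearMap.ker_eq_bot.mp <|
    h _ ⟨(f.quotKerEquivOfSurjective hf).symm.toLinearMap, LinearEquiv.injective _⟩

theorem not_isBassian_finsupp (ι : Type*) [Infinite ι] [Nontrivial M] :
    ¬ IsBassian R (ι →₀ M) := by
  classical
  intro h
  obtain ⟨e⟩ : Nonempty (Option ι ≃ ι) := Cardinal.eq.mp <| by
    rw [Cardinal.mk_option, Cardinal.mk_add_one_eq]
  have hu : Function.Injective (e ∘ some) := e.injective.comp (Option.some_injective ι)
  obtain ⟨x, hx⟩ := exists_ne (0 : M)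
  have inj := h.injective_of_surjective (Finsupp.lcomapDomain (e ∘ some) hu)
    (Finsupp.leftInverse_lcomapDomain_mapDomain _ hu).surjective
  have : Finsupp.single (e none) x = 0 := inj <| by
    ext j
    simp [Finsupp.lcomapDomain]
  exact hx (Finsupp.single_eq_zero.mp this)

theorem Submodule.le_socle (N : Submodule R M) [IsSemisimpleModule R N] : N ≤ Socle R M := by
  rw [← N.map_subtype_top, ← IsSemisimpleModule.sSup_simples_eq_top R N, sSup_eq_iSup,
    Submodule.map_iSup]
  refine iSup_le fun S ↦ ?_
  rw [Submodule.map_iSup]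
  refine iSup_le fun hS ↦ le_sSup (isSimpleModule_iff_isAtom.mp ?_)
  have : IsSimpleModule R S := hS
  exact .congr (S.equivMapOfInjective _ N.subtype_injective).symm

instance isSemisimpleModule_socle : IsSemisimpleModule R (Socle R M) := by
  rw [Socle, sSup_eq_iSup]
  refine isSemisimpleModule_biSup_of_isSemisimpleModule_submodule fun S hS ↦ ?_
  have := isSimpleModule_iff_isAtom.mpr hS
  infer_instance

/-- The submodule of elements annihilated by a two-sided ideal. -/
def Ideal.annihilated (I : Ideal R) [I.IsTwoSided] (M : Type*) [AddCommGroup M] [Module R M] :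
    Submodule R M where
  carrier := {x | ∀ r ∈ I, r • x = 0}
  add_mem' hx hy r hr := by rw [smul_add, hx r hr, hy r hr, add_zero]
  zero_mem' r _ := smul_zero r
  smul_mem' a x hx r hr := by rw [smul_smul]; exact hx _ (I.mul_mem_right a hr)

variable (I : Ideal R) [I.IsTwoSided]

theorem Ideal.annihilated_le_socle [IsSemisimpleModule R (R ⧸ I)] :
    I.annihilated M ≤ Socle R M := by
  intro x hx
  let f : (R ⧸ I) →ₗ[R] M := Submodule.liftQ I (LinearMap.toSpanSingleton R M x) hx
  have := IsSemisimpleModule.range f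
  exact (LinearMap.range f).le_socle ⟨Submodule.Quotient.mk 1, one_smul R x⟩

instance isNoetherian_annihilated_submodule [IsNoetherian R (I.annihilated M)]
    (N : Submodule R M) : IsNoetherian R (I.annihilated N) :=
  isNoetherian_of_injective
    (LinearMap.codRestrict (I.annihilated M) (N.subtype ∘ₗ (I.annihilated N).subtype)
      fun x r hr ↦ congrArg Subtype.val (x.2 r hr))
    ((LinearMap.injective_codRestrict_iff ..).mpr
      (N.subtype_injective.comp (I.annihilated N).subtype_injective))

theorem subsingleton_of_locally_nilpotent_surjective {n : ℕ}
    (hn : ∀ g : Fin n → R, (∀ i, g i ∈ I) → (List.ofFn g).prod = 0)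
    [IsNoetherian R (I.annihilated M)] (f : Module.End R M) (hf : Function.Surjective f)
    (hnil : ∀ x, ∃ k, (f ^ k) x = 0) : Subsingleton M := by
  obtain ⟨s, hs⟩ : (I.annihilated M).FG := Module.Finite.iff_fg.mp inferInstance
  choose k hk using hnil
  obtain ⟨m, hm⟩ : ∃ m, ∀ x ∈ I.annihilated M, (f ^ m) x = 0 := by
    refine ⟨s.sup k, fun x hx ↦ ?_⟩
    rw [← hs] at hx
    refine (Submodule.span_le (p := LinearMap.ker (f ^ s.sup k))).mpr (fun y hy ↦ ?_) hx
    exact Module.End.pow_map_zero_of_le (Finset.le_sup hy) (hk y)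
  have hsurj : Function.Surjective (f ^ m) := by
    rw [Module.End.coe_pow]; exact hf.iterate m
  have key : ∀ j, ∀ x : M, (∀ g : Fin j → R, (∀ i, g i ∈ I) → (List.ofFn g).prod • x = 0) →
      ((f ^ m) ^ j) x = 0 := by
    intro j
    induction j with
    | zero => intro x hx; simpa using hx Fin.elim0 (fun i ↦ i.elim0)
    | succ j ih =>
      intro x hx
      rw [pow_succ, Module.End.mul_apply]
      refine ih _ fun g hg ↦ ?_
      rw [← map_smul]
      refine hm _ fun r hr ↦ ?_
      simpa [List.ofFn_succ, mul_smul] using hx (Fin.cons r g) (Fin.cases hr hg)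
  refine subsingleton_of_forall_eq 0 fun x ↦ ?_
  obtain ⟨y, rfl⟩ : ∃ y, ((f ^ m) ^ n) y = x := by
    have := hsurj.iterate n
    rw [← Module.End.coe_pow] at this
    exact this x
  exact key n y fun g hg ↦ by rw [hn g hg, zero_smul]

/-- The `k`-th iterated kernel of a partial endomorphism `g : P → M`. -/
def iteratedKernel {P : Submodule R M} (g : P →ₗ[R] M) : ℕ → Submodule R M
  | 0 => ⊥
  | k + 1 => ((iteratedKernel g k).comap g).map P.subtype

theorem mem_iteratedKernel_succ {P : Submodule R M} (g : P →ₗ[R] M) (k : ℕ) (x : M) :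
    x ∈ iteratedKernel g (k + 1) ↔ ∃ h : x ∈ P, g ⟨x, h⟩ ∈ iteratedKernel g k := by
  simp [iteratedKernel]

theorem iteratedKernel_mono {P : Submodule R M} (g : P →ₗ[R] M) : Monotone (iteratedKernel g) := by
  refine monotone_nat_of_le_succ fun k ↦ ?_
  induction k with
  | zero => exact bot_le
  | succ k ih => exact Submodule.map_mono (Submodule.comap_mono ih)

theorem mem_iSup_iteratedKernel {P : Submodule R M} (g : P →ₗ[R] M) (x : M) :
    x ∈ ⨆ k, iteratedKernel g k ↔ ∃ k, x ∈ iteratedKernel g k :=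
  Submodule.mem_iSup_of_directed _ (iteratedKernel_mono g).directed_le

theorem ker_eq_bot_of_surjective_partial {n : ℕ}
    (hn : ∀ g : Fin n → R, (∀ i, g i ∈ I) → (List.ofFn g).prod = 0)
    [IsNoetherian R (I.annihilated M)] {P : Submodule R M} (g : P →ₗ[R] M)
    (hg : Function.Surjective g) : LinearMap.ker g = ⊥ := by
  set X : Submodule R M := ⨆ k, iteratedKernel g k
  have step (x : M) (hx : x ∈ X) : ∃ h : x ∈ P, g ⟨x, h⟩ ∈ X := by
    obtain ⟨k, hk⟩ := (mem_iSup_iteratedKernel g x).mp hx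
    obtain ⟨h, h'⟩ := (mem_iteratedKernel_succ g k x).mp (iteratedKernel_mono g k.le_succ hk)
    exact ⟨h, (mem_iSup_iteratedKernel g _).mpr ⟨k, h'⟩⟩
  have hXP : X ≤ P := fun x hx ↦ (step x hx).1
  let f : Module.End R X := LinearMap.codRestrict X (g ∘ₗ Submodule.inclusion hXP)
    fun x ↦ (step x x.2).2
  have hf : Function.Surjective f := by
    rintro ⟨y, hy⟩
    obtain ⟨⟨p, hp⟩, rfl⟩ := hg y
    obtain ⟨k, hk⟩ := (mem_iSup_iteratedKernel g _).mp hy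
    exact ⟨⟨p, (mem_iSup_iteratedKernel g p).mpr
      ⟨k + 1, (mem_iteratedKernel_succ g k p).mpr ⟨hp, hk⟩⟩⟩, rfl⟩
  have hnil (k : ℕ) : ∀ x : X, x.1 ∈ iteratedKernel g k → (f ^ k) x = 0 := by
    induction k with
    | zero => exact fun x hx ↦ Subtype.ext hx
    | succ k ih =>
      intro x hx
      rw [pow_succ, Module.End.mul_apply]
      exact ih _ ((mem_iteratedKernel_succ g k x).mp hx).2
  have := subsingleton_of_locally_nilpotent_surjective I hn f hf fun x ↦
    ((mem_iSup_iteratedKernel g x).mp x.2).imp fun k hk ↦ hnil k x hk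
  refine (Submodule.eq_bot_iff _).mpr fun p hp ↦ ?_
  have hpX : p.1 ∈ X := (mem_iSup_iteratedKernel g _).mpr
    ⟨1, (mem_iteratedKernel_succ g 0 p).mpr ⟨p.2, hp⟩⟩
  exact Subtype.ext <| show (p : M) = 0 from
    congrArg Subtype.val (Subsingleton.elim (⟨p, hpX⟩ : X) 0)

theorem isBassian_of_isNoetherian_annihilated {n : ℕ}
    (hn : ∀ g : Fin n → R, (∀ i, g i ∈ I) → (List.ofFn g).prod = 0)
    [IsNoetherian R (I.annihilated M)] : IsBassian R M := by
  rintro N ⟨f, hf⟩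
  let e := LinearEquiv.ofInjective f hf
  let P := (LinearMap.range f).comap N.mkQ
  let g : P →ₗ[R] M := e.symm.toLinearMap ∘ₗ N.mkQ.restrict (fun _ hx ↦ hx)
  have hg : Function.Surjective g := by
    refine e.symm.surjective.comp ?_
    rintro ⟨y, hy⟩
    obtain ⟨x, rfl⟩ := N.mkQ_surjective y
    exact ⟨⟨x, hy⟩, rfl⟩
  have hker := ker_eq_bot_of_surjective_partial I hn g hg
  refine (Submodule.eq_bot_iff _).mpr fun x hx ↦ ?_
  have hx0 : N.mkQ x = 0 := (Submodule.Quotient.mk_eq_zero N).mpr hx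
  have hxP : x ∈ P := by
    change N.mkQ x ∈ LinearMap.range f
    rw [hx0]; exact zero_mem _
  have : (⟨x, hxP⟩ : P) ∈ LinearMap.ker g := by
    rw [LinearMap.mem_ker]
    exact e.symm.map_eq_zero_iff.mpr (Subtype.ext hx0)
  rw [hker] at this
  exact congrArg Subtype.val this

theorem exists_submodule_quotient_linearEquiv [IsSemisimpleModule R (R ⧸ Ring.jacobson R)]
    (S : Type*) [AddCommGroup S] [Module R S] [IsSimpleModule R S] :
    ∃ T : Submodule R (R ⧸ Ring.jacobson R), Nonempty (S ≃ₗ[R] T) := by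
  obtain ⟨K, hK, ⟨e⟩⟩ := isSimpleModule_iff_quot_maximal.mp ‹IsSimpleModule R S›
  have hle : Ring.jacobson R ≤ K := sInf_le hK.out
  let f : (R ⧸ Ring.jacobson R) →ₗ[R] R ⧸ K := Submodule.factor hle
  obtain ⟨T, ⟨e'⟩⟩ := IsSemisimpleModule.exists_submodule_linearEquiv_quotient (LinearMap.ker f)
  exact ⟨T, ⟨(e'.trans (f.quotKerEquivOfSurjective (Submodule.factor_surjective hle))).trans
    e.symm |>.symm⟩⟩

theorem finite_isotypicComponents [IsSemisimpleModule R (R ⧸ Ring.jacobson R)] :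
    Finite (isotypicComponents R M) := by
  choose S hS hc using fun c : isotypicComponents R M ↦ c.2
  choose T e using fun c ↦ exists_submodule_quotient_linearEquiv (R := R) (S c)
  have hT (c) : IsSimpleModule R (T c) := .congr (e c).some.symm
  refine Finite.of_injective (β := isotypicComponents R (R ⧸ Ring.jacobson R))
    (fun c ↦ ⟨isotypicComponent R _ (T c), T c, hT c, rfl⟩) fun c d h ↦ ?_
  have h' : isotypicComponent R (R ⧸ Ring.jacobson R) (T c) = isotypicComponent R _ (T d) :=
    congrArg Subtype.val h
  obtain ⟨e'⟩ := isIsotypicOfType_submodule_iff.mp (.isotypicComponent R _ (T d)) (T c)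
    (h' ▸ (T c).le_isotypicComponent)
  refine Subtype.ext ?_
  rw [hc c, hc d]
  exact (((e c).some.trans e').trans (e d).some.symm).isotypicComponent_eq

theorem IsBassian.finite_of_isIsotypic [IsSemisimpleModule R M] [Nontrivial M]
    (h : IsBassian R M) (iso : IsIsotypic R M) : Module.Finite R M := by
  obtain ⟨ι, _, S, hS, ⟨e⟩⟩ := iso.linearEquiv_finsupp
  have := IsSimpleModule.nontrivial R S
  rcases finite_or_infinite ι
  · exact .equiv e.symm
  · exact (not_isBassian_finsupp ι (isBassian_of_linearEquiv e h)).elim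

theorem IsHereditarilyBassian.socle_fg [IsSemisimpleModule R (R ⧸ Ring.jacobson R)]
    (h : IsHereditarilyBassian R M) : (Socle R M).FG := by
  have := finite_isotypicComponents (R := R) (M := Socle R M)
  rw [← Module.Finite.iff_fg, Module.finite_def, ← sSup_isotypicComponents, sSup_eq_iSup']
  refine Submodule.fg_iSup _ fun c ↦ Module.Finite.iff_fg.mp ?_
  exact IsBassian.finite_of_isIsotypic (isBassian_of_linearEquiv
    (c.1.equivMapOfInjective _ (Socle R M).subtype_injective).symm (h _)) (.isotypicComponents c.2)

end

/-- Over a semilocal ring with nilpotent Jacobson radical, a module is hereditarily Bassian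
iff its socle is finitely generated. -/
theorem hereditarilyBassian_iff_socle_fg (R : Type*) [Ring R] (M : Type*) [AddCommGroup M]
    [Module R M]
    (hsl : IsSemisimpleModule R (R ⧸ (⊥ : Ideal R).jacobson))
    (hnil : ∃ n : ℕ, ∀ g : Fin n → R,
      (∀ i, g i ∈ (⊥ : Ideal R).jacobson) → (List.ofFn g).prod = 0) :
    IsHereditarilyBassian R M ↔ (Socle R M).FG := by
  rw [Ideal.jacobson_bot] at hsl hnil
  obtain ⟨n, hn⟩ := hnil
  refine ⟨fun h ↦ h.socle_fg, fun h N ↦ ?_⟩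
  have : Module.Finite R (Socle R M) := Module.Finite.iff_fg.mpr h
  have : IsNoetherian R ((Ring.jacobson R).annihilated M) :=
    isNoetherian_of_le (Ring.jacobson R).annihilated_le_socle
  exact isBassian_of_isNoetherian_annihilated (Ring.jacobson R) hn
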